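/- Let N be a positive integer, p a prime exactly dividing N (i.e. p ∣ N and p ∤ N/p), k an even integer, and f : ℍ → ℂ a function transforming like a modular form of weight k for Γ₀(N). Define (f∣U_p)(τ) = p^{k/2−1} Σ_{j=0}^{p−1} (f∣ₖ(1, j; 0, p))(τ), equivalently (f∣U_p)(τ) = (1/p) Σ_{j=0}^{p−1} f((τ+j)/p). Then for any Atkin-Lehner matrix W_p for p at level N, the function f∣U_p + p^{k/2−1}·(f∣ₖW_p) transforms like a modular form of weight k for the larger group Γ₀(N/p). -/

import Mathlib

noncomputable section

open Complex Matrix Finset UpperHalfPlane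

/-- Möbius action of a real `2×2` matrix on the upper half-plane (this is the genuine
Möbius action `τ ↦ (aτ+b)/(cτ+d)` whenever the matrix has positive determinant). -/
def moebius (g : Matrix (Fin 2) (Fin 2) ℝ) (τ : UpperHalfPlane) : UpperHalfPlane :=
  if h : 0 < ((((g 0 0 : ℝ) : ℂ) * (τ : ℂ) + ((g 0 1 : ℝ) : ℂ)) /
      (((g 1 0 : ℝ) : ℂ) * (τ : ℂ) + ((g 1 1 : ℝ) : ℂ))).im then
    UpperHalfPlane.mk _ h else τ

/-- The weight-`k` slash action of a real `2×2` matrix, normalized with `det ^ (k/2)`. -/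
def slash (k : ℤ) (g : Matrix (Fin 2) (Fin 2) ℝ) (f : UpperHalfPlane → ℂ) :
    UpperHalfPlane → ℂ :=
  fun τ => ((g.det : ℝ) : ℂ) ^ ((k : ℂ) / 2) *
    (((g 1 0 : ℝ) : ℂ) * (τ : ℂ) + ((g 1 1 : ℝ) : ℂ)) ^ (-k) * f (moebius g τ)

/-- `g` is (the image in `SL₂(ℝ)` of) an integer matrix of determinant `1` whose
lower-left entry is divisible by `N`, i.e. an element of `Γ₀(N)`. -/
def MemGamma0 (N : ℕ) (g : Matrix (Fin 2) (Fin 2) ℝ) : Prop :=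
  (∃ a b c d : ℤ, g = !![(a : ℝ), (b : ℝ); (c : ℝ), (d : ℝ)] ∧ (N : ℤ) ∣ c) ∧ g.det = 1

/-- `f` transforms like a modular form of weight `k` for `Γ₀(N)`. -/
def TransformsLike (N : ℕ) (k : ℤ) (f : UpperHalfPlane → ℂ) : Prop :=
  ∀ g, MemGamma0 N g → slash k g f = f

/-- An Atkin-Lehner matrix for the exact divisor `Q` at level `N`:
`W_Q = (1/√Q)·(Qx, y; Nz, Qt)` with integer entries and determinant `1`. -/
def IsAtkinLehner (N Q : ℕ) (W : Matrix (Fin 2) (Fin 2) ℝ) : Prop :=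
  (∃ x y z t : ℤ,
      W = (Real.sqrt Q)⁻¹ • !![(Q : ℝ) * x, (y : ℝ); (N : ℝ) * z, (Q : ℝ) * t]) ∧
    W.det = 1

/-- The matrix `B_m = (1/√m)·(m, 0; 0, 1)`. -/
def Bmat (m : ℕ) : Matrix (Fin 2) (Fin 2) ℝ :=
  (Real.sqrt m)⁻¹ • !![(m : ℝ), 0; 0, 1]

/-- The `m`-th Hecke operator of weight `k` and level `N`:
`(f∣T_m)(τ) = m^{k/2−1} Σ_{ad = m, gcd(a,N)=1} Σ_{b=0}^{d−1} (f∣ₖ(a, b; 0, d))(τ)`. -/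
def hecke (N : ℕ) (k : ℤ) (m : ℕ) (f : UpperHalfPlane → ℂ) : UpperHalfPlane → ℂ :=
  fun τ => (m : ℂ) ^ ((k : ℂ) / 2 - 1) *
    ∑ a ∈ m.divisors, if Nat.gcd a N = 1 then
      ∑ b ∈ Finset.range (m / a), slash k !![(a : ℝ), (b : ℝ); 0, ((m / a : ℕ) : ℝ)] f τ
    else 0

/-- The weight-`0` operator `U_m`: `(f∣U_m)(τ) = (1/m) Σ_{j=0}^{m−1} f((τ+j)/m)`. -/
def U0 (m : ℕ) (f : UpperHalfPlane → ℂ) : UpperHalfPlane → ℂ :=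
  fun τ => (1 / (m : ℂ)) * ∑ j ∈ Finset.range m, f (moebius !![1, (j : ℝ); 0, (m : ℝ)] τ)

/-- The weight-`0` operator `B_m`: `(f∣B_m)(τ) = f(mτ)`. -/
def B0 (m : ℕ) (f : UpperHalfPlane → ℂ) : UpperHalfPlane → ℂ :=
  fun τ => f (moebius !![(m : ℝ), 0; 0, 1] τ)

/-- The weight-`0` action of a matrix: `(f∣W)(τ) = f(W·τ)`. -/
def W0 (W : Matrix (Fin 2) (Fin 2) ℝ) (f : UpperHalfPlane → ℂ) : UpperHalfPlane → ℂ :=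
  fun τ => f (moebius W τ)

/-- `f` is invariant under `Γ₀(N)` in weight `0`. -/
def Inv0 (N : ℕ) (f : UpperHalfPlane → ℂ) : Prop :=
  ∀ g, MemGamma0 N g → ∀ τ, f (moebius g τ) = f τ

theorem linear_ne_zero_of_det_pos {g : Matrix (Fin 2) (Fin 2) ℝ} (hg : 0 < g.det) (τ : ℍ) :
    (((g 1 0 : ℝ) : ℂ) * (τ : ℂ) + ((g 1 1 : ℝ) : ℂ)) ≠ 0 := by
  intro h
  have him := congrArg Complex.im h
  have hre := congrArg Complex.re h
  simp at him hre
  rw [Matrix.det_fin_two] at hg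
  rcases him with h0 | h0
  · rw [h0] at hre hg
    simp at hre
    simp [hre] at hg
  · exact τ.im_pos.ne' h0

theorem coe_moebius {g : Matrix (Fin 2) (Fin 2) ℝ} (hg : 0 < g.det) (τ : ℍ) :
    ((moebius g τ : ℍ) : ℂ) = (((g 0 0 : ℝ) : ℂ) * (τ : ℂ) + ((g 0 1 : ℝ) : ℂ)) /
      (((g 1 0 : ℝ) : ℂ) * (τ : ℂ) + ((g 1 1 : ℝ) : ℂ)) := by
  have hden := linear_ne_zero_of_det_pos hg τ
  have hpos : 0 < ((((g 0 0 : ℝ) : ℂ) * (τ : ℂ) + ((g 0 1 : ℝ) : ℂ)) /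
      (((g 1 0 : ℝ) : ℂ) * (τ : ℂ) + ((g 1 1 : ℝ) : ℂ))).im := by
    have hn := Complex.normSq_pos.2 hden
    rw [Complex.div_im, ← sub_div]
    refine div_pos ?_ hn
    have : 0 < g.det * τ.im := mul_pos hg τ.im_pos
    rw [Matrix.det_fin_two] at this
    simp
    linarith
  rw [moebius, dif_pos hpos]

theorem moebius_mul {g h : Matrix (Fin 2) (Fin 2) ℝ} (hg : 0 < g.det) (hh : 0 < h.det) (τ : ℍ) :
    moebius (g * h) τ = moebius g (moebius h τ) := by
  have hgh : 0 < (g * h).det := by rw [Matrix.det_mul]; exact mul_pos hg hh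
  have h1 := linear_ne_zero_of_det_pos hh τ
  have h2 := linear_ne_zero_of_det_pos hgh τ
  have h3 := linear_ne_zero_of_det_pos hg (moebius h τ)
  ext1
  rw [coe_moebius hgh, coe_moebius hg, div_eq_div_iff h2 h3, coe_moebius hh]
  simp only [Matrix.mul_apply, Fin.sum_univ_two]
  push_cast
  field_simp
  ring

theorem slash_mul {k : ℤ} (hk : Even k) {g h : Matrix (Fin 2) (Fin 2) ℝ} (hg : 0 < g.det)
    (hh : 0 < h.det) (f : ℍ → ℂ) : slash k (g * h) f = slash k h (slash k g f) := by
  obtain ⟨m, rfl⟩ := hk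
  have hm : (((m + m : ℤ) : ℂ) / 2) = (m : ℂ) := by push_cast; ring
  funext τ
  have h1 := linear_ne_zero_of_det_pos hh τ
  have hco : (((g * h) 1 0 : ℝ) : ℂ) * (τ : ℂ) + (((g * h) 1 1 : ℝ) : ℂ) =
      (((g 1 0 : ℝ) : ℂ) * (moebius h τ : ℂ) + ((g 1 1 : ℝ) : ℂ)) *
        (((h 1 0 : ℝ) : ℂ) * (τ : ℂ) + ((h 1 1 : ℝ) : ℂ)) := by
    rw [coe_moebius hh]
    simp only [Matrix.mul_apply, Fin.sum_univ_two]
    push_cast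
    field_simp
    ring
  simp only [slash, hm, Complex.cpow_intCast]
  rw [hco, moebius_mul hg hh, Matrix.det_mul, Complex.ofReal_mul, mul_zpow, mul_zpow]
  ring

theorem slash_smul {k : ℤ} (hk : Even k) {g : Matrix (Fin 2) (Fin 2) ℝ} (hg : 0 < g.det)
    {c : ℝ} (hc : 0 < c) (f : ℍ → ℂ) : slash k (c • g) f = slash k g f := by
  have hc' : (c : ℂ) ≠ 0 := by exact_mod_cast hc.ne'
  have hdet : (c • g).det = c ^ 2 * g.det := by simp
  have hcg : 0 < (c • g).det := by rw [hdet]; positivity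
  obtain ⟨m, rfl⟩ := hk
  have hm : (((m + m : ℤ) : ℂ) / 2) = (m : ℂ) := by push_cast; ring
  funext τ
  have hmo : moebius (c • g) τ = moebius g τ := by
    ext1
    rw [coe_moebius hcg, coe_moebius hg,
      div_eq_div_iff (linear_ne_zero_of_det_pos hcg τ) (linear_ne_zero_of_det_pos hg τ)]
    simp only [Matrix.smul_apply, smul_eq_mul]
    push_cast
    ring
  have hden : (((c • g) 1 0 : ℝ) : ℂ) * (τ : ℂ) + (((c • g) 1 1 : ℝ) : ℂ) =
      c * (((g 1 0 : ℝ) : ℂ) * (τ : ℂ) + ((g 1 1 : ℝ) : ℂ)) := by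
    simp only [Matrix.smul_apply, smul_eq_mul]
    push_cast
    ring
  have hcc : ((c : ℂ) ^ 2) ^ m * (c : ℂ) ^ (-(m + m)) = 1 := by
    rw [← zpow_natCast, ← _root_.zpow_mul, ← zpow_add₀ hc']
    simp [two_mul]
  simp only [slash, hm, Complex.cpow_intCast]
  rw [hden, hmo, hdet, Complex.ofReal_mul, Complex.ofReal_pow, mul_zpow, mul_zpow]
  linear_combination (((g.det : ℝ) : ℂ) ^ m *
    (((g 1 0 : ℝ) : ℂ) * (τ : ℂ) + ((g 1 1 : ℝ) : ℂ)) ^ (-(m + m)) * f (moebius g τ)) * hcc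

/-- The real matrix underlying an integer matrix. -/
abbrev toReal (A : Matrix (Fin 2) (Fin 2) ℤ) : Matrix (Fin 2) (Fin 2) ℝ :=
  A.map (Int.cast : ℤ → ℝ)

theorem toReal_det (A : Matrix (Fin 2) (Fin 2) ℤ) : (toReal A).det = (A.det : ℝ) := by
  simp [toReal, Matrix.det_fin_two]

theorem toReal_mul (A B : Matrix (Fin 2) (Fin 2) ℤ) : toReal (A * B) = toReal A * toReal B := by
  ext i j
  simp [toReal, Matrix.mul_apply]

/-- Twisting by `diag(1, p)` turns invariance under `Γ₀(pM)` into invariance under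
`Γ₀(M) ∩ Γ⁰(p)`. -/
theorem slash_slash_diag {k : ℤ} (hk : Even k) {M p : ℕ} (hp : 0 < p) {f : ℍ → ℂ}
    (hf : TransformsLike (p * M) k f) {A : Matrix (Fin 2) (Fin 2) ℤ} (hA : A.det = 1)
    (hb : (p : ℤ) ∣ A 0 1) (hc : (M : ℤ) ∣ A 1 0) :
    slash k (toReal A) (slash k (toReal !![1, 0; 0, (p : ℤ)]) f) =
      slash k (toReal !![1, 0; 0, (p : ℤ)]) f := by
  obtain ⟨b, hb⟩ := hb
  have hD : 0 < (toReal !![1, 0; 0, (p : ℤ)]).det := by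
    rw [toReal_det]; simpa [Matrix.det_fin_two] using hp
  set B : Matrix (Fin 2) (Fin 2) ℤ := !![A 0 0, b; p * A 1 0, A 1 1] with hBdef
  have hBdet : B.det = 1 := by
    rw [Matrix.det_fin_two, hb] at hA
    simp only [hBdef, Matrix.det_fin_two_of]
    linarith
  have hB1 : (toReal B).det = 1 := by rw [toReal_det, hBdet]; norm_num
  have hA1 : (toReal A).det = 1 := by rw [toReal_det, hA]; norm_num
  have hcomm : !![1, 0; 0, (p : ℤ)] * A = B * !![1, 0; 0, (p : ℤ)] := by
    ext i j
    fin_cases i <;> fin_cases j <;> simp [hBdef, Matrix.mul_apply, Fin.sum_univ_two, hb, mul_comm]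
  have hBf : slash k (toReal B) f = f := by
    refine hf _ ⟨⟨A 0 0, b, p * A 1 0, A 1 1, ?_, ?_⟩, hB1⟩
    · ext i j
      fin_cases i <;> fin_cases j <;> simp [hBdef, toReal]
    · push_cast
      exact mul_dvd_mul_left _ hc
  rw [← slash_mul hk hD (by rw [hA1]; exact one_pos), ← toReal_mul, hcomm, toReal_mul,
    slash_mul hk (by rw [hB1]; exact one_pos) hD, hBf]

/-- If `g` is invariant under `Γ₀(M) ∩ Γ⁰(p)`, then on `Γ₀(M)` the slash `g ∣ A` depends only on
the class of the top row of `A` in the projective line over `𝔽_p`. -/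
theorem slash_eq_of_dvd_cross {k : ℤ} (hk : Even k) {M p : ℕ} {g : ℍ → ℂ}
    (hg : ∀ A : Matrix (Fin 2) (Fin 2) ℤ, A.det = 1 → (p : ℤ) ∣ A 0 1 → (M : ℤ) ∣ A 1 0 →
      slash k (toReal A) g = g)
    {A B : Matrix (Fin 2) (Fin 2) ℤ} (hA : A.det = 1) (hB : B.det = 1)
    (hMA : (M : ℤ) ∣ A 1 0) (hMB : (M : ℤ) ∣ B 1 0)
    (h : (p : ℤ) ∣ A 0 0 * B 0 1 - A 0 1 * B 0 0) :
    slash k (toReal A) g = slash k (toReal B) g := by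
  have hC : (A * B.adjugate).det = 1 := by
    rw [Matrix.det_mul, Matrix.det_adjugate, hA, hB]; simp
  have hAB : A = A * B.adjugate * B := by
    rw [Matrix.mul_assoc, Matrix.adjugate_mul, hB, one_smul, Matrix.mul_one]
  have hinv := hg (A * B.adjugate) hC
    (by
      simp only [Matrix.adjugate_fin_two, Matrix.mul_apply, Fin.sum_univ_two]
      simp
      obtain ⟨u, hu⟩ := h
      exact ⟨-u, by linear_combination -hu⟩)
    (by
      simp only [Matrix.adjugate_fin_two, Matrix.mul_apply, Fin.sum_univ_two]
      simp
      exact dvd_add (hMA.mul_right _) ((hMB.mul_left _).neg_right))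
  rw [hAB, toReal_mul, slash_mul hk (by rw [toReal_det, hC]; norm_num)
    (by rw [toReal_det, hB]; norm_num), hinv]

/-- Coset representatives of `Γ₀(M) ∩ Γ⁰(p)` in `Γ₀(M)`: the translations by `0, …, p - 1`,
together with an extra matrix `V`. -/
def cosetRep (p : ℕ) (V : Matrix (Fin 2) (Fin 2) ℤ) : Option (Fin p) → Matrix (Fin 2) (Fin 2) ℤ
  | none => V
  | some j => !![1, (j : ℕ); 0, 1]

theorem dvd_cross_trans {p : ℤ} {A B C : Matrix (Fin 2) (Fin 2) ℤ} (hC : C.det = 1)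
    (hAC : p ∣ A 0 0 * C 0 1 - A 0 1 * C 0 0) (hBC : p ∣ B 0 0 * C 0 1 - B 0 1 * C 0 0) :
    p ∣ A 0 0 * B 0 1 - A 0 1 * B 0 0 := by
  obtain ⟨u, hu⟩ := hAC
  obtain ⟨v, hv⟩ := hBC
  rw [Matrix.det_fin_two] at hC
  refine ⟨C 1 1 * (u * B 0 0 - v * A 0 0) - C 1 0 * (u * B 0 1 - v * A 0 1), ?_⟩
  linear_combination (C 1 1 * B 0 0 - C 1 0 * B 0 1) * hu - (C 1 1 * A 0 0 - C 1 0 * A 0 1) * hv -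
    (A 0 0 * B 0 1 - A 0 1 * B 0 0) * hC

theorem cosetRep_injective {p : ℕ} (hp : p.Prime) {V : Matrix (Fin 2) (Fin 2) ℤ}
    (hV : V.det = 1) (hpV : (p : ℤ) ∣ V 0 0) {i j : Option (Fin p)}
    (h : (p : ℤ) ∣ cosetRep p V i 0 0 * cosetRep p V j 0 1 -
      cosetRep p V i 0 1 * cosetRep p V j 0 0) : i = j := by
  have hV1 : ¬ (p : ℤ) ∣ V 0 1 := by
    intro h1
    rw [Matrix.det_fin_two] at hV
    have : (p : ℤ) ∣ 1 := hV ▸ dvd_sub (hpV.mul_right _) (h1.mul_right _)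
    exact (Nat.prime_iff_prime_int.1 hp).not_dvd_one this
  rcases i with _ | i <;> rcases j with _ | j
  · rfl
  · simp only [cosetRep, Matrix.of_apply, Matrix.cons_val', Matrix.cons_val_zero,
      Matrix.cons_val_one, mul_one] at h
    exact absurd ((dvd_sub_right (hpV.mul_right _)).1 h) hV1
  · simp only [cosetRep, Matrix.of_apply, Matrix.cons_val', Matrix.cons_val_zero,
      Matrix.cons_val_one, one_mul] at h
    exact absurd ((dvd_sub_left (hpV.mul_left _)).1 h) hV1
  · simp [cosetRep] at h
    have := (Nat.modEq_iff_dvd.2 h).eq_of_lt_of_lt i.2 j.2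
    rw [Fin.ext this]

theorem exists_cosetRep_dvd_cross {p : ℕ} (hp : p.Prime) {V : Matrix (Fin 2) (Fin 2) ℤ}
    (hpV : (p : ℤ) ∣ V 0 0) (A : Matrix (Fin 2) (Fin 2) ℤ) :
    ∃ i, (p : ℤ) ∣ A 0 0 * cosetRep p V i 0 1 - A 0 1 * cosetRep p V i 0 0 := by
  have : Fact p.Prime := ⟨hp⟩
  by_cases ha : (p : ℤ) ∣ A 0 0
  · exact ⟨none, dvd_sub (ha.mul_right _) (hpV.mul_left _)⟩
  · have ha' : ((A 0 0 : ℤ) : ZMod p) ≠ 0 := by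
      rwa [Ne, ZMod.intCast_zmod_eq_zero_iff_dvd]
    let z : ZMod p := (A 0 1 : ZMod p) * ((A 0 0 : ℤ) : ZMod p)⁻¹
    refine ⟨some ⟨z.val, z.val_lt⟩, ?_⟩
    rw [← ZMod.intCast_zmod_eq_zero_iff_dvd]
    simp only [cosetRep, Matrix.of_apply, Matrix.cons_val', Matrix.cons_val_zero,
      Matrix.cons_val_one, mul_one]
    push_cast
    rw [ZMod.natCast_zmod_val]
    simp only [z]
    field_simp
    ring

/-- The trace of a `Γ₀(M) ∩ Γ⁰(p)`-invariant function is `Γ₀(M)`-invariant. -/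
theorem slash_sum_cosetRep {k : ℤ} (hk : Even k) {M p : ℕ} (hp : p.Prime) {g : ℍ → ℂ}
    (hg : ∀ A : Matrix (Fin 2) (Fin 2) ℤ, A.det = 1 → (p : ℤ) ∣ A 0 1 → (M : ℤ) ∣ A 1 0 →
      slash k (toReal A) g = g)
    {V : Matrix (Fin 2) (Fin 2) ℤ} (hV : V.det = 1) (hpV : (p : ℤ) ∣ V 0 0)
    (hMV : (M : ℤ) ∣ V 1 0) {A : Matrix (Fin 2) (Fin 2) ℤ} (hA : A.det = 1)
    (hMA : (M : ℤ) ∣ A 1 0) (τ : ℍ) :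
    ∑ i, slash k (toReal A) (slash k (toReal (cosetRep p V i)) g) τ =
      ∑ i, slash k (toReal (cosetRep p V i)) g τ := by
  have hdet : ∀ i, (cosetRep p V i).det = 1 := by
    rintro (_ | j)
    · exact hV
    · simp [cosetRep]
  have hM : ∀ i, (M : ℤ) ∣ cosetRep p V i 1 0 := by
    rintro (_ | j)
    · exact hMV
    · simp [cosetRep]
  choose σ hσ using fun i => exists_cosetRep_dvd_cross hp hpV (cosetRep p V i * A)
  have hinj : Function.Injective σ := by
    intro i j hij
    have hj := hσ j
    rw [← hij] at hj
    have h := dvd_cross_trans (hdet _) (hσ i) hj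
    refine cosetRep_injective hp hV hpV ?_
    rw [Matrix.det_fin_two] at hA
    simp only [Matrix.mul_apply, Fin.sum_univ_two] at h
    convert h using 1
    linear_combination -(cosetRep p V i 0 0 * cosetRep p V j 0 1 -
      cosetRep p V i 0 1 * cosetRep p V j 0 0) * hA
  refine Fintype.sum_bijective σ (Finite.injective_iff_bijective.1 hinj) _ _ fun i => ?_
  rw [← slash_mul hk (by rw [toReal_det, hdet]; norm_num) (by rw [toReal_det, hA]; norm_num),
    ← toReal_mul]
  refine congrFun (slash_eq_of_dvd_cross hk hg ?_ (hdet _) ?_ (hM _) (hσ i)) τ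
  · rw [Matrix.det_mul, hdet, hA, one_mul]
  · simp only [Matrix.mul_apply, Fin.sum_univ_two]
    exact dvd_add ((hM i).mul_right _) (hMA.mul_left _)

/-- If `p` is a prime exactly dividing `N` and `f` transforms like a
modular form of even weight `k` for `Γ₀(N)`, then `f∣U_p + p^{k/2−1}·(f∣ₖW_p)`, where
`(f∣U_p)(τ) = p^{k/2−1} Σ_{j=0}^{p−1} (f∣ₖ(1, j; 0, p))(τ)`, transforms like a modular
form of weight `k` for the larger group `Γ₀(N/p)`. -/
theorem Up_add_atkinLehner_level_lower (N : ℕ) (hN : 0 < N) (p : ℕ) (hp : p.Prime)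
    (hpN : p ∣ N) (hpe : ¬ p ∣ N / p)
    (k : ℤ) (hk : Even k) (f : UpperHalfPlane → ℂ) (hf : TransformsLike N k f)
    (W : Matrix (Fin 2) (Fin 2) ℝ) (hW : IsAtkinLehner N p W) :
    TransformsLike (N / p) k (fun τ =>
      (p : ℂ) ^ ((k : ℂ) / 2 - 1) *
          ∑ j ∈ Finset.range p, slash k !![1, (j : ℝ); 0, (p : ℝ)] f τ +
        (p : ℂ) ^ ((k : ℂ) / 2 - 1) * slash k W f τ) := by
  obtain ⟨M, rfl⟩ := hpN
  have hp0 : 0 < p := hp.pos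
  have hpR : (0 : ℝ) < p := by exact_mod_cast hp0
  rw [Nat.mul_div_cancel_left M hp0]
  obtain ⟨⟨x, y, z, t, rfl⟩, hWdet⟩ := hW
  set D : Matrix (Fin 2) (Fin 2) ℤ := !![1, 0; 0, (p : ℤ)] with hDdef
  set V : Matrix (Fin 2) (Fin 2) ℤ := !![p * x, y; M * z, t] with hVdef
  have hD : 0 < (toReal D).det := by
    rw [toReal_det]; simpa [hDdef, Matrix.det_fin_two] using hp0
  have hDV : !![(p : ℝ) * x, (y : ℝ); ((p * M : ℕ) : ℝ) * z, (p : ℝ) * t] = toReal D * toReal V := by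
    ext i j
    fin_cases i <;> fin_cases j <;>
      simp [hDdef, hVdef, toReal, Matrix.mul_apply, Fin.sum_univ_two, mul_assoc]
  have hs : 0 < (Real.sqrt p)⁻¹ := inv_pos.2 (Real.sqrt_pos.2 hpR)
  have hV : V.det = 1 := by
    rw [hDV, Matrix.det_smul, Matrix.det_mul, toReal_det, toReal_det, Fintype.card_fin, inv_pow,
      Real.sq_sqrt hpR.le] at hWdet
    have hDd : D.det = p := by simp [hDdef]
    rw [hDd, Int.cast_natCast, inv_mul_cancel_left₀ hpR.ne'] at hWdet
    exact_mod_cast hWdet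
  have hVR : 0 < (toReal V).det := by rw [toReal_det, hV]; norm_num
  have hpV : (p : ℤ) ∣ V 0 0 := ⟨x, rfl⟩
  have hMV : (M : ℤ) ∣ V 1 0 := ⟨z, rfl⟩
  set G := slash k (toReal D) f with hG
  have hsum : (fun τ : ℍ => (p : ℂ) ^ ((k : ℂ) / 2 - 1) *
      ∑ j ∈ Finset.range p, slash k !![1, (j : ℝ); 0, (p : ℝ)] f τ +
      (p : ℂ) ^ ((k : ℂ) / 2 - 1) * slash k ((Real.sqrt p)⁻¹ •
        !![(p : ℝ) * x, (y : ℝ); ((p * M : ℕ) : ℝ) * z, (p : ℝ) * t]) f τ) =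
      fun τ => (p : ℂ) ^ ((k : ℂ) / 2 - 1) * ∑ i, slash k (toReal (cosetRep p V i)) G τ := by
    funext τ
    rw [← mul_add, Fintype.sum_option, add_comm, Finset.sum_range]
    congr 2
    · rw [hDV, slash_smul hk (by rw [Matrix.det_mul]; exact mul_pos hD hVR) hs,
        slash_mul hk hD hVR]
      rfl
    · refine Finset.sum_congr rfl fun j _ => ?_
      rw [hG, ← slash_mul hk hD (by rw [toReal_det]; simp [cosetRep]), ← toReal_mul]
      congr 1
      ext a b
      fin_cases a <;> fin_cases b <;>
        simp [hDdef, cosetRep, toReal]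
  rw [hsum]
  rintro γ ⟨⟨a, b, c, d, rfl, hc⟩, hdet⟩
  have hγ : !![(a : ℝ), (b : ℝ); (c : ℝ), (d : ℝ)] = toReal !![a, b; c, d] := by
    ext i j
    fin_cases i <;> fin_cases j <;> simp [toReal]
  rw [hγ] at hdet ⊢
  rw [toReal_det] at hdet
  funext τ
  rw [← slash_sum_cosetRep hk hp (g := G) (fun A h1 h2 h3 => slash_slash_diag hk hp0 hf h1 h2 h3)
    hV hpV hMV (A := !![a, b; c, d]) (by exact_mod_cast hdet) hc τ]
  simp only [slash, Finset.mul_sum]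
  refine Finset.sum_congr rfl fun i _ => ?_
  ring
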